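/- Let A : ℝ → ℝ be Lipschitz with constant L, let p ∈ (1,∞), and let b ∈ BMO(ℝ). If the commutator [b, C_Γ] is a compact operator on L^p(ℝ), then b ∈ VMO(ℝ). -/

import Mathlib

open MeasureTheory Filter Set
open scoped ENNReal

/-- The Cauchy kernel `K(x,y) = 1/(y - x + i(A(y) - A(x)))` associated to `A`. -/
noncomputable def cauchyKernel (A : ℝ → ℝ) (x y : ℝ) : ℂ :=
  ((y : ℂ) - (x : ℂ) + Complex.I * ((A y : ℂ) - (A x : ℂ)))⁻¹

/-- `cauchyPV A f x v` : the principal value `C_Γ f (x)` exists and equals `v`. -/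
def cauchyPV (A : ℝ → ℝ) (f : ℝ → ℂ) (x : ℝ) (v : ℂ) : Prop :=
  Filter.Tendsto (fun δ : ℝ => ∫ y in {y : ℝ | δ < |y - x|}, cauchyKernel A x y * f y)
    (nhdsWithin 0 (Set.Ioi 0)) (nhds v)

/-- `g` agrees a.e. with the commutator `[b, C_Γ] f = b • C_Γ f - C_Γ (b f)`. -/
def IsCommutatorFn (A b : ℝ → ℝ) (f g : ℝ → ℂ) : Prop :=
  ∀ᵐ x : ℝ, ∃ u w : ℂ,
    cauchyPV A f x u ∧ cauchyPV A (fun y => (b y : ℂ) * f y) x w ∧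
    g x = (b x : ℂ) * u - w

/-- Average of `b` over the interval `I(x,r) = (x - r, x + r)`. -/
noncomputable def intervalAvg (b : ℝ → ℝ) (x r : ℝ) : ℝ :=
  (2 * r)⁻¹ * ∫ y in Set.Ioo (x - r) (x + r), b y

/-- Mean oscillation `M(b, I(x,r))`. -/
noncomputable def meanOsc (b : ℝ → ℝ) (x r : ℝ) : ℝ :=
  (2 * r)⁻¹ * ∫ y in Set.Ioo (x - r) (x + r), |b y - intervalAvg b x r|

def IsBMOWith (b : ℝ → ℝ) (N : ℝ) : Prop :=
  MeasureTheory.LocallyIntegrable b volume ∧ ∀ x r : ℝ, 0 < r → meanOsc b x r ≤ N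

/-- `b ∈ BMO(ℝ)`. -/
def IsBMO (b : ℝ → ℝ) : Prop := ∃ N : ℝ, IsBMOWith b N

/-- `‖b‖_BMO`, the supremum of the mean oscillations of `b` over all bounded intervals. -/
noncomputable def bmoNorm (b : ℝ → ℝ) : ℝ := sInf {N : ℝ | IsBMOWith b N}

/-- `b ∈ VMO(ℝ)` : `b ∈ BMO(ℝ)` and the mean oscillations vanish for short intervals,
for long intervals, and for intervals far from the origin. -/
def IsVMO (b : ℝ → ℝ) : Prop :=
  IsBMO b ∧
  (∀ ε : ℝ, 0 < ε → ∃ δ : ℝ, 0 < δ ∧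
      ∀ x r : ℝ, 0 < r → 2 * r < δ → meanOsc b x r < ε) ∧
  (∀ ε : ℝ, 0 < ε → ∃ R : ℝ, 0 < R ∧
      ∀ x r : ℝ, 0 < r → R < 2 * r → meanOsc b x r < ε) ∧
  (∀ ε : ℝ, 0 < ε → ∃ R : ℝ, 0 < R ∧
      ∀ x r : ℝ, 0 < r → Set.Ioo (x - r) (x + r) ∩ Set.Ioo (-R) R = ∅ →
        meanOsc b x r < ε)

/-- A finite measure on `ℝ` has a median. -/
theorem exists_median (ν : Measure ℝ) [IsFiniteMeasure ν] :
    ∃ m : ℝ, ν univ / 2 ≤ ν (Iic m) ∧ ν univ / 2 ≤ ν (Ici m) := by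
  rcases eq_or_ne (ν univ) 0 with h0 | h0
  · exact ⟨0, by simp [h0], by simp [h0]⟩
  have hlt : ν univ / 2 < ν univ := ENNReal.half_lt_self h0 (measure_ne_top _ _)
  set S : Set ℝ := {t | ν univ / 2 ≤ ν (Iic t)}
  have hne : S.Nonempty := by
    obtain ⟨t, ht⟩ := ((tendsto_measure_Iic_atTop ν).eventually (lt_mem_nhds hlt)).exists
    exact ⟨t, ht.le⟩
  have hbdd : BddBelow S := by
    have hbot : Tendsto (fun t : ℝ => ν (Ici t)) atBot (nhds (ν univ)) :=
      tendsto_measure_Ici_atBot ν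
    obtain ⟨t, ht⟩ := (hbot.eventually (lt_mem_nhds hlt)).exists
    refine ⟨t, fun s hs => ?_⟩
    by_contra! hst
    have hsum : ν (Iic s) + ν (Ici t) ≤ ν univ := by
      rw [← measure_union _ measurableSet_Ici]
      · exact measure_mono (subset_univ _)
      · exact Set.disjoint_left.2 fun a ha hb => absurd (hb.trans ha) (not_le.2 hst)
    have hgt : ν univ / 2 + ν univ / 2 < ν (Iic s) + ν (Ici t) :=
      ENNReal.add_lt_add_of_le_of_lt (ENNReal.div_ne_top (measure_ne_top _ _) (by simp)) hs ht
    rw [ENNReal.add_halves] at hgt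
    exact absurd hsum (not_le.2 hgt)
  refine ⟨sInf S, ?_, ?_⟩
  · obtain ⟨u, hu, hlt', hlim⟩ := exists_seq_strictAnti_tendsto (sInf S)
    have hI : Iic (sInf S) = ⋂ n, Iic (u n) := by
      ext a
      simp only [mem_Iic, mem_iInter]
      exact ⟨fun h n => h.trans (hlt' n).le, fun h => ge_of_tendsto' hlim h⟩
    rw [hI]
    refine ge_of_tendsto' (tendsto_measure_iInter_atTop
      (fun n => measurableSet_Iic.nullMeasurableSet)
      (fun i j hij => Iic_subset_Iic.2 (hu.antitone hij)) ⟨0, measure_ne_top _ _⟩) fun n => ?_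
    obtain ⟨s, hs, hsu⟩ := exists_lt_of_csInf_lt hne (hlt' n)
    exact le_trans hs (measure_mono (Iic_subset_Iic.2 hsu.le))
  · obtain ⟨u, hu, hlt', hlim⟩ := exists_seq_strictMono_tendsto (sInf S)
    have hI : Ici (sInf S) = ⋂ n, Ioi (u n) := by
      ext a
      simp only [mem_Ici, mem_iInter, mem_Ioi]
      exact ⟨fun h n => (hlt' n).trans_le h, fun h => le_of_tendsto' hlim fun n => (h n).le⟩
    rw [hI]
    refine ge_of_tendsto' (tendsto_measure_iInter_atTop
      (fun n => measurableSet_Ioi.nullMeasurableSet)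
      (fun i j hij => Ioi_subset_Ioi (hu.monotone hij)) ⟨0, measure_ne_top _ _⟩) fun n => ?_
    have hn : ν (Iic (u n)) < ν univ / 2 :=
      not_le.1 fun h => absurd (csInf_le hbdd h) (not_le.2 (hlt' n))
    simp only [Function.comp_apply]
    rw [← compl_Iic, measure_compl measurableSet_Iic (measure_ne_top _ _)]
    refine ENNReal.le_sub_of_add_le_left (measure_ne_top _ _) ?_
    calc ν (Iic (u n)) + ν univ / 2 ≤ ν univ / 2 + ν univ / 2 := by gcongr
      _ = ν univ := ENNReal.add_halves _

theorem measurable_cauchyKernel {A : ℝ → ℝ} (hA : Measurable A) (x : ℝ) :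
    Measurable (cauchyKernel A x) := by
  unfold cauchyKernel
  fun_prop

theorem abs_sub_le_norm_cauchyKernel_denom (A : ℝ → ℝ) (x y : ℝ) :
    |y - x| ≤ ‖(y : ℂ) - (x : ℂ) + Complex.I * ((A y : ℂ) - (A x : ℂ))‖ := by
  simpa using
    Complex.abs_re_le_norm ((y : ℂ) - (x : ℂ) + Complex.I * ((A y : ℂ) - (A x : ℂ)))

theorem norm_cauchyKernel_denom_le {A : ℝ → ℝ} {L : ℝ}
    (hA : ∀ x₁ x₂ : ℝ, |A x₁ - A x₂| ≤ L * |x₁ - x₂|) (x y : ℝ) :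
    ‖(y : ℂ) - (x : ℂ) + Complex.I * ((A y : ℂ) - (A x : ℂ))‖ ≤ (1 + L) * |y - x| := by
  calc _ ≤ ‖(y : ℂ) - (x : ℂ)‖ + ‖Complex.I * ((A y : ℂ) - (A x : ℂ))‖ := norm_add_le _ _
    _ = |y - x| + |A y - A x| := by
      rw [norm_mul, Complex.norm_I, one_mul, ← Complex.ofReal_sub, ← Complex.ofReal_sub,
        Complex.norm_real, Complex.norm_real, Real.norm_eq_abs, Real.norm_eq_abs]
    _ ≤ (1 + L) * |y - x| := by linarith [hA y x]

theorem le_norm_cauchyKernel {A : ℝ → ℝ} {L : ℝ}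
    (hA : ∀ x₁ x₂ : ℝ, |A x₁ - A x₂| ≤ L * |x₁ - x₂|) {x y : ℝ} (hxy : x ≠ y) :
    ((1 + L) * |y - x|)⁻¹ ≤ ‖cauchyKernel A x y‖ := by
  rw [cauchyKernel, norm_inv]
  have h0 : 0 < |y - x| := abs_pos.2 (sub_ne_zero.2 hxy.symm)
  exact inv_anti₀ (h0.trans_le (abs_sub_le_norm_cauchyKernel_denom A x y))
    (norm_cauchyKernel_denom_le hA x y)

/-- The Cauchy kernel is nearly constant in `y` at a large relative distance from `x`. -/
theorem norm_cauchyKernel_sub_le {A : ℝ → ℝ} {L : ℝ}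
    (hA : ∀ x₁ x₂ : ℝ, |A x₁ - A x₂| ≤ L * |x₁ - x₂|) {x y y₀ : ℝ}
    (hxy : x ≠ y) (hxy₀ : x ≠ y₀) (h : 2 * ((1 + L) * |y - y₀|) ≤ |y - x|) :
    ‖cauchyKernel A x y - cauchyKernel A x y₀‖ ≤ 2⁻¹ * ‖cauchyKernel A x y₀‖ := by
  have hz := abs_sub_le_norm_cauchyKernel_denom A x y
  have hw := abs_sub_le_norm_cauchyKernel_denom A x y₀
  have hzw := norm_cauchyKernel_denom_le hA y y₀
  unfold cauchyKernel
  have h1 : 0 < |y - x| := abs_pos.2 (sub_ne_zero.2 hxy.symm)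
  have h2 : 0 < |y₀ - x| := abs_pos.2 (sub_ne_zero.2 hxy₀.symm)
  set z := (y : ℂ) - (x : ℂ) + Complex.I * ((A y : ℂ) - (A x : ℂ)) with hzdef
  set w := (y₀ : ℂ) - (x : ℂ) + Complex.I * ((A y₀ : ℂ) - (A x : ℂ)) with hwdef
  have hz0 : 0 < ‖z‖ := h1.trans_le hz
  have hw0 : 0 < ‖w‖ := h2.trans_le hw
  have hd : (y₀ : ℂ) - (y : ℂ) + Complex.I * ((A y₀ : ℂ) - (A y : ℂ)) = w - z := by
    rw [hzdef, hwdef]; ring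
  rw [hd, abs_sub_comm] at hzw
  rw [inv_sub_inv (norm_pos_iff.1 hz0) (norm_pos_iff.1 hw0), norm_div, norm_mul, norm_inv,
    div_le_iff₀ (by positivity)]
  have : 2⁻¹ * ‖w‖⁻¹ * (‖z‖ * ‖w‖) = 2⁻¹ * ‖z‖ := by field_simp
  rw [this]
  linarith

/-- Away from the support of the function the principal value is an ordinary integral. -/
theorem cauchyPV_eq_setIntegral {A : ℝ → ℝ} {f g : ℝ → ℂ} {F : Set ℝ} (hF : MeasurableSet F)
    (hf : f =ᵐ[volume] F.indicator g) {x δ : ℝ} (hδ : 0 < δ) (hsep : ∀ y ∈ F, δ < |y - x|)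
    {u : ℂ} (h : cauchyPV A f x u) : u = ∫ y in F, cauchyKernel A x y * g y := by
  refine tendsto_nhds_unique h (tendsto_const_nhds.congr' ?_)
  filter_upwards [Ioo_mem_nhdsGT hδ] with δ' hδ'
  have h1 : ∫ y in {y : ℝ | δ' < |y - x|}, cauchyKernel A x y * f y =
      ∫ y in {y : ℝ | δ' < |y - x|}, F.indicator (fun y => cauchyKernel A x y * g y) y := by
    refine integral_congr_ae (ae_restrict_of_ae ?_)
    filter_upwards [hf] with y hy
    rw [hy]
    by_cases hyF : y ∈ F <;> simp [hyF]
  have h2 : {y : ℝ | δ' < |y - x|} ∩ F = F :=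
    inter_eq_right.2 fun y hy => hδ'.2.trans (hsep y hy)
  rw [h1, setIntegral_indicator hF, h2]

/-- Integrating a nonnegative function against an almost constant kernel produces no
cancellation. -/
theorem norm_integral_mul_ge {α : Type*} [MeasurableSpace α] {μ : Measure α} {ψ : α → ℝ}
    {k : α → ℂ} {k₀ : ℂ} (hψ : Integrable ψ μ) (hψ0 : 0 ≤ᵐ[μ] ψ) (hk : AEStronglyMeasurable k μ)
    (hk₀ : ∀ᵐ y ∂μ, ‖k y - k₀‖ ≤ 2⁻¹ * ‖k₀‖) :
    2⁻¹ * ‖k₀‖ * ∫ y, ψ y ∂μ ≤ ‖∫ y, k y * ψ y ∂μ‖ := by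
  have hrest : Integrable (fun y => (k y - k₀) * (ψ y : ℂ)) μ :=
    hψ.ofReal.bdd_mul (hk.sub aestronglyMeasurable_const) hk₀
  have hconst : Integrable (fun y => k₀ * (ψ y : ℂ)) μ := hψ.ofReal.const_mul _
  have hsplit : ∫ y, k y * ψ y ∂μ = k₀ * ((∫ y, ψ y ∂μ : ℝ) : ℂ) +
      ∫ y, (k y - k₀) * (ψ y : ℂ) ∂μ := by
    rw [← integral_complex_ofReal, ← integral_const_mul, ← integral_add hconst hrest]
    refine integral_congr_ae (.of_forall fun y => ?_)
    simp only
    ring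
  have herr : ‖∫ y, (k y - k₀) * (ψ y : ℂ) ∂μ‖ ≤ 2⁻¹ * ‖k₀‖ * ∫ y, ψ y ∂μ := by
    rw [← integral_const_mul]
    refine norm_integral_le_of_norm_le (hψ.const_mul _) ?_
    filter_upwards [hk₀, hψ0] with y hy hy0
    rw [norm_mul, Complex.norm_real, Real.norm_of_nonneg hy0]
    exact mul_le_mul_of_nonneg_right hy hy0
  have hmain : ‖k₀ * ((∫ y, ψ y ∂μ : ℝ) : ℂ)‖ = ‖k₀‖ * ∫ y, ψ y ∂μ := by
    rw [norm_mul, Complex.norm_real, Real.norm_of_nonneg (integral_nonneg_of_ae hψ0)]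
  have htri := norm_sub_le_norm_add (k₀ * ((∫ y, ψ y ∂μ : ℝ) : ℂ))
    (∫ y, (k y - k₀) * (ψ y : ℂ) ∂μ)
  rw [hsplit]
  linarith

theorem meanOsc_le {b : ℝ → ℝ} (hb : LocallyIntegrable b) (x : ℝ) {r : ℝ} (hr : 0 < r) (m : ℝ) :
    r * meanOsc b x r ≤ ∫ y in Ioo (x - r) (x + r), |b y - m| := by
  have hI : IntegrableOn b (Ioo (x - r) (x + r)) :=
    (hb.integrableOn_isCompact isCompact_Icc).mono_set Ioo_subset_Icc_self
  have hvol : (volume : Measure ℝ).real (Ioo (x - r) (x + r)) = 2 * r := by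
    rw [Real.volume_real_Ioo_of_le (by linarith)]; ring
  have hc : ∀ t : ℝ, IntegrableOn (fun _ => t) (Ioo (x - r) (x + r)) := fun t => by simp
  have hcint : ∀ t : ℝ, ∫ _ in Ioo (x - r) (x + r), t = 2 * r * t := fun t => by
    rw [setIntegral_const, hvol, smul_eq_mul]
  have havg : 2 * r * |m - intervalAvg b x r| ≤ ∫ y in Ioo (x - r) (x + r), |b y - m| := by
    have : 2 * r * (m - intervalAvg b x r) = - ∫ y in Ioo (x - r) (x + r), (b y - m) := by
      rw [integral_sub hI (hc m), hcint, intervalAvg]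
      field_simp
      ring
    rw [← abs_of_pos (by positivity : 0 < 2 * r), ← abs_mul, this, abs_neg]
    exact abs_integral_le_integral_abs
  have hosc : ∫ y in Ioo (x - r) (x + r), |b y - intervalAvg b x r| ≤
      (∫ y in Ioo (x - r) (x + r), |b y - m|) + 2 * r * |m - intervalAvg b x r| := by
    have habs : ∀ t : ℝ, IntegrableOn (fun y => |b y - t|) (Ioo (x - r) (x + r)) :=
      fun t => (hI.sub (hc t)).abs
    rw [← hcint, ← integral_add (habs m) (hc _)]
    exact integral_mono (habs _) ((habs m).add (hc _))
      fun y => abs_sub_le _ _ _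
  have : r * meanOsc b x r = 2⁻¹ * ∫ y in Ioo (x - r) (x + r), |b y - intervalAvg b x r| := by
    rw [meanOsc]; field_simp
  rw [this]
  linarith

/-- One of the one-sided oscillations around `m` carries half of the mean oscillation. -/
theorem exists_sign_oscillation {b : ℝ → ℝ} (hbm : Measurable b) (hb : LocallyIntegrable b)
    (x : ℝ) {r : ℝ} (hr : 0 < r) (m : ℝ) :
    ∃ σ : ℝ, (σ = 1 ∨ σ = -1) ∧ r * meanOsc b x r / 2 ≤
      ∫ y in Ioo (x - r) (x + r) ∩ {y | 0 ≤ σ * (b y - m)}, σ * (b y - m) := by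
  have hI : IntegrableOn (fun y => b y - m) (Ioo (x - r) (x + r)) :=
    ((hb.integrableOn_isCompact isCompact_Icc).mono_set Ioo_subset_Icc_self).sub (by simp)
  have hmeas : ∀ σ : ℝ, MeasurableSet {y | 0 ≤ σ * (b y - m)} := fun σ =>
    measurableSet_le measurable_const (by fun_prop)
  have hind : ∀ σ : ℝ, IntegrableOn ({y | 0 ≤ σ * (b y - m)}.indicator
      fun y => σ * (b y - m)) (Ioo (x - r) (x + r)) := fun σ =>
    (hI.const_mul σ).indicator (hmeas σ)
  have hsum : ∫ y in Ioo (x - r) (x + r), |b y - m| ≤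
      (∫ y in Ioo (x - r) (x + r) ∩ {y | 0 ≤ 1 * (b y - m)}, 1 * (b y - m)) +
      ∫ y in Ioo (x - r) (x + r) ∩ {y | 0 ≤ (-1) * (b y - m)}, (-1) * (b y - m) := by
    rw [← setIntegral_indicator (hmeas 1), ← setIntegral_indicator (hmeas (-1)),
      ← integral_add (hind 1) (hind (-1))]
    refine integral_mono hI.abs ((hind 1).add (hind (-1))) fun y => ?_
    simp only [indicator_apply, mem_ofPred_eq]
    rcases abs_cases (b y - m) with ⟨h, h'⟩ | ⟨h, h'⟩ <;> split_ifs <;> linarith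
  have := meanOsc_le hb x hr m
  by_contra! hcon
  have h1 := hcon 1 (Or.inl rfl)
  have h2 := hcon (-1) (Or.inr rfl)
  linarith

/-- Pointwise formula for the commutator away from the support of an indicator function. -/
theorem commutator_indicator_apply {A b : ℝ → ℝ} (hAm : Measurable A) (hb : LocallyIntegrable b)
    {f g : ℝ → ℂ} (h : IsCommutatorFn A b f g) {F E : Set ℝ} (hF : MeasurableSet F) {c : ℂ}
    (hf : f =ᵐ[volume] F.indicator fun _ => c) {δ : ℝ} (hδ : 0 < δ)
    (hsep : ∀ x ∈ E, ∀ y ∈ F, δ < |y - x|) {x₀ r : ℝ} (hFI : F ⊆ Ioo (x₀ - r) (x₀ + r)) :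
    ∀ᵐ x : ℝ, x ∈ E → g x = c * ∫ y in F, cauchyKernel A x y * ((b x - b y : ℝ) : ℂ) := by
  filter_upwards [h] with x hx hxE
  obtain ⟨u, w, hu, hw, hg⟩ := hx
  have hbf : (fun y => (b y : ℂ) * f y) =ᵐ[volume] F.indicator fun y => (b y : ℂ) * c := by
    filter_upwards [hf] with y hy
    rw [hy]
    by_cases hyF : y ∈ F <;> simp [hyF]
  have hbF : IntegrableOn b F :=
    (hb.integrableOn_isCompact isCompact_Icc).mono_set (hFI.trans Ioo_subset_Icc_self)
  have hFfin : volume F ≠ ⊤ := measure_ne_top_of_subset hFI (by simp)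
  have hkb : ∀ᵐ y ∂volume.restrict F, ‖cauchyKernel A x y‖ ≤ δ⁻¹ := by
    filter_upwards [ae_restrict_mem hF] with y hy
    rw [cauchyKernel, norm_inv]
    exact inv_anti₀ hδ ((hsep x hxE y hy).le.trans (abs_sub_le_norm_cauchyKernel_denom A x y))
  have hk := (measurable_cauchyKernel hAm x).aestronglyMeasurable (μ := volume.restrict F)
  have hi1 : IntegrableOn (fun y => cauchyKernel A x y * ((b x : ℂ) * c)) F :=
    Integrable.bdd_mul (integrableOn_const hFfin) hk hkb
  have hi2 : IntegrableOn (fun y => cauchyKernel A x y * ((b y : ℂ) * c)) F :=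
    Integrable.bdd_mul (hbF.ofReal.mul_const c) hk hkb
  rw [hg, cauchyPV_eq_setIntegral hF hf hδ (hsep x hxE) hu,
    cauchyPV_eq_setIntegral hF hbf hδ (hsep x hxE) hw, ← integral_const_mul,
    ← integral_const_mul]
  have : ∫ y in F, (b x : ℂ) * (cauchyKernel A x y * c) =
      ∫ y in F, cauchyKernel A x y * ((b x : ℂ) * c) :=
    integral_congr_ae (.of_forall fun y => by ring)
  rw [this, ← integral_sub hi1 hi2]
  refine integral_congr_ae (.of_forall fun y => ?_)
  push_cast
  ring

/-- On every interval there is a normalized function on which the commutator is bounded below by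
the mean oscillation, on a large part of a neighbouring interval. -/
theorem exists_test_function {A : ℝ → ℝ} {L : ℝ} (hL : 0 < L)
    (hA : ∀ x₁ x₂ : ℝ, |A x₁ - A x₂| ≤ L * |x₁ - x₂|) (hAm : Measurable A)
    {p : ℝ≥0∞} (hp0 : p ≠ 0) (hp2 : p ≠ ⊤) {b : ℝ → ℝ} (hbm : Measurable b)
    (hb : LocallyIntegrable b) {T : Lp ℂ p (volume : Measure ℝ) → Lp ℂ p (volume : Measure ℝ)}
    (hT : ∀ f : Lp ℂ p (volume : Measure ℝ), IsCommutatorFn A b ⇑f ⇑(T f))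
    (x₀ : ℝ) {r : ℝ} (hr : 0 < r) :
    ∃ f : Lp ℂ p (volume : Measure ℝ), ‖f‖ ≤ 1 ∧ ∃ E : Set ℝ, MeasurableSet E ∧
      E ⊆ Ioo (x₀ + (2 * L + 3) * r) (x₀ + (2 * L + 5) * r) ∧ ENNReal.ofReal r ≤ volume E ∧
      ∀ᵐ x : ℝ, x ∈ E → (4 * (1 + L) * (2 * L + 5))⁻¹ * meanOsc b x₀ r *
        (2 * r) ^ (-(1 / p.toReal)) ≤ ‖T f x‖ := by
  set J := Ioo (x₀ + (2 * L + 3) * r) (x₀ + (2 * L + 5) * r) with hJ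
  set I := Ioo (x₀ - r) (x₀ + r) with hI
  have hJvol : volume J = ENNReal.ofReal (2 * r) := by
    rw [hJ, Real.volume_Ioo]; congr 1; ring
  have : IsFiniteMeasure ((volume.restrict J).map b) := by
    have : IsFiniteMeasure (volume.restrict J) :=
      ⟨by rw [Measure.restrict_apply_univ, hJvol]; exact ENNReal.ofReal_lt_top⟩
    infer_instance
  obtain ⟨m, hm1, hm2⟩ := exists_median ((volume.restrict J).map b)
  have hhalf : ((volume.restrict J).map b) univ / 2 = ENNReal.ofReal r := by
    rw [Measure.map_apply hbm .univ, preimage_univ, Measure.restrict_apply .univ, univ_inter,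
      hJvol, ← ENNReal.ofReal_ofNat 2, ← ENNReal.ofReal_div_of_pos two_pos]
    congr 1
    ring
  rw [hhalf, Measure.map_apply hbm measurableSet_Iic,
    Measure.restrict_apply (hbm measurableSet_Iic)] at hm1
  rw [hhalf, Measure.map_apply hbm measurableSet_Ici,
    Measure.restrict_apply (hbm measurableSet_Ici)] at hm2
  obtain ⟨σ, hσ, hσosc⟩ := exists_sign_oscillation hbm hb x₀ hr m
  set F := I ∩ {y | 0 ≤ σ * (b y - m)} with hFdef
  have hF : MeasurableSet F := measurableSet_Ioo.inter
    (measurableSet_le measurable_const (by fun_prop))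
  have hFvol : volume F ≤ ENNReal.ofReal (2 * r) := by
    refine (measure_mono inter_subset_left).trans_eq ?_
    rw [hI, Real.volume_Ioo]; congr 1; ring
  have hFfin : volume F ≠ ⊤ := ne_top_of_le_ne_top ENNReal.ofReal_ne_top hFvol
  set E := J ∩ {x | σ * (b x - m) ≤ 0} with hEdef
  have hE : MeasurableSet E := measurableSet_Ioo.inter
    (measurableSet_le (by fun_prop) measurable_const)
  have hEvol : ENNReal.ofReal r ≤ volume E := by
    rcases hσ with rfl | rfl
    · refine hm1.trans (measure_mono fun x hx => ⟨hx.2, ?_⟩)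
      have : b x ≤ m := hx.1
      simpa using this
    · refine hm2.trans (measure_mono fun x hx => ⟨hx.2, ?_⟩)
      have : m ≤ b x := hx.1
      simpa using this
  have hp : 0 < p.toReal := ENNReal.toReal_pos hp0 hp2
  set s : ℝ := (2 * r) ^ (-(1 / p.toReal)) with hs
  have hs0 : 0 < s := by positivity
  have hsep : ∀ x ∈ E, ∀ y ∈ F, (2 * L + 2) * r < |y - x| := fun x hx y hy => by
    have h1 := hx.1.1
    have h2 := hy.1.2
    rw [abs_sub_comm, lt_abs]
    left
    linarith
  refine ⟨indicatorConstLp p hF hFfin (s : ℂ), ?_, E, hE, inter_subset_left, hEvol, ?_⟩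
  · rw [norm_indicatorConstLp hp0 hp2, Complex.norm_real, Real.norm_of_nonneg hs0.le]
    have hFr : (volume : Measure ℝ).real F ≤ 2 * r :=
      ENNReal.toReal_le_of_le_ofReal (by positivity) hFvol
    calc s * (volume : Measure ℝ).real F ^ (1 / p.toReal) ≤ s * (2 * r) ^ (1 / p.toReal) := by
          gcongr
      _ = 1 := by
          rw [hs, ← Real.rpow_add (by positivity)]; simp
  · filter_upwards [commutator_indicator_apply hAm hb
      (hT (indicatorConstLp p hF hFfin (s : ℂ))) hF indicatorConstLp_coeFn
      (by positivity : 0 < (2 * L + 2) * r) hsep inter_subset_left] with x hx hxE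
    rw [hx hxE]
    have hx1 := hxE.1.1
    have hx2 := hxE.1.2
    have hxx₀ : |x₀ - x| = x - x₀ := by
      rw [abs_sub_comm]
      exact abs_of_nonneg (by nlinarith)
    have hne : x ≠ x₀ := by
      intro h
      rw [h] at hx1
      nlinarith
    have hbF : IntegrableOn b F :=
      (hb.integrableOn_isCompact isCompact_Icc).mono_set
        (inter_subset_left.trans Ioo_subset_Icc_self)
    have hcF : ∀ t : ℝ, IntegrableOn (fun _ => t) F := fun t => integrableOn_const hFfin
    have hψ : IntegrableOn (fun y => σ * (b y - b x)) F := (hbF.sub (hcF _)).const_mul σ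
    have hle : ∀ y ∈ F, σ * (b y - m) ≤ σ * (b y - b x) := fun y hy => by
      have : σ * (b x - m) ≤ 0 := hxE.2
      linarith
    have hψ0 : 0 ≤ᵐ[volume.restrict F] fun y => σ * (b y - b x) := by
      filter_upwards [ae_restrict_mem hF] with y hy
      exact le_trans hy.2 (hle y hy)
    have hk₀ : ∀ᵐ y ∂volume.restrict F,
        ‖cauchyKernel A x y - cauchyKernel A x x₀‖ ≤ 2⁻¹ * ‖cauchyKernel A x x₀‖ := by
      filter_upwards [ae_restrict_mem hF] with y hy
      have hd := hsep x hxE y hy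
      refine norm_cauchyKernel_sub_le hA ?_ hne ?_
      · rintro rfl
        rw [sub_self, abs_zero] at hd
        have : 0 < (2 * L + 2) * r := by positivity
        linarith
      · have hy1 := hy.1.1
        have hy2 := hy.1.2
        have : |y - x₀| ≤ r := abs_le.2 ⟨by linarith, by linarith⟩
        nlinarith
    have hlow := norm_integral_mul_ge hψ hψ0
      (measurable_cauchyKernel hAm x).aestronglyMeasurable hk₀
    have hnorm : ‖∫ y in F, cauchyKernel A x y * ((b x - b y : ℝ) : ℂ)‖ =
        ‖∫ y in F, cauchyKernel A x y * ((σ * (b y - b x) : ℝ) : ℂ)‖ := by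
      have : ∫ y in F, cauchyKernel A x y * ((σ * (b y - b x) : ℝ) : ℂ) =
          (-σ : ℂ) * ∫ y in F, cauchyKernel A x y * ((b x - b y : ℝ) : ℂ) := by
        rw [← integral_const_mul]
        refine integral_congr_ae (.of_forall fun y => ?_)
        push_cast
        ring
      rw [this, norm_mul]
      rcases hσ with rfl | rfl <;> simp
    have hKlow : ((1 + L) * ((2 * L + 5) * r))⁻¹ ≤ ‖cauchyKernel A x x₀‖ := by
      refine le_trans ?_ (le_norm_cauchyKernel hA hne)
      have : 0 < x - x₀ := by nlinarith
      rw [hxx₀]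
      gcongr
      linarith
    have hrest : r * meanOsc b x₀ r / 2 ≤ ∫ y in F, σ * (b y - b x) :=
      hσosc.trans (setIntegral_mono_on ((hbF.sub (hcF m)).const_mul σ) hψ hF hle)
    rw [norm_mul, Complex.norm_real, Real.norm_of_nonneg hs0.le, hnorm, mul_comm _ s]
    refine mul_le_mul_of_nonneg_left (le_trans ?_ hlow) hs0.le
    calc (4 * (1 + L) * (2 * L + 5))⁻¹ * meanOsc b x₀ r
        = 2⁻¹ * ((1 + L) * ((2 * L + 5) * r))⁻¹ * (r * meanOsc b x₀ r / 2) := by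
          field_simp; ring
      _ ≤ 2⁻¹ * ((1 + L) * ((2 * L + 5) * r))⁻¹ * ∫ y in F, σ * (b y - b x) := by gcongr
      _ ≤ 2⁻¹ * ‖cauchyKernel A x x₀‖ * ∫ y in F, σ * (b y - b x) := by
          have := integral_nonneg_of_ae hψ0
          gcongr

/-- Relatively compact families in `L^p(ℝ)` are uniformly approximated by functions with a common
bound and a common bounded support. -/
theorem exists_uniform_approx {p : ℝ≥0∞} [Fact (1 ≤ p)] (hp2 : p ≠ ⊤)
    {K : Set (Lp ℂ p (volume : Measure ℝ))} (hK : IsCompact K) {η : ℝ} (hη : 0 < η) :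
    ∃ B S : ℝ, 0 < B ∧ 0 < S ∧ ∀ h ∈ K, ∃ φ : ℝ → ℂ, AEStronglyMeasurable φ volume ∧
      (∀ x, ‖φ x‖ ≤ B) ∧ (∀ x, x ∉ Icc (-S) S → φ x = 0) ∧
      eLpNorm (⇑h - φ) p volume ≤ ENNReal.ofReal η := by
  have happ : ∀ h : Lp ℂ p (volume : Measure ℝ), ∃ φ : ℝ → ℂ, ∃ B S : ℝ, Continuous φ ∧
      (∀ x, ‖φ x‖ ≤ B) ∧ (∀ x, x ∉ Icc (-S) S → φ x = 0) ∧
      eLpNorm (⇑h - φ) p volume ≤ ENNReal.ofReal (η / 2) := by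
    intro h
    obtain ⟨φ, hc, happ, hcont, -⟩ := (Lp.memLp h).exists_hasCompactSupport_eLpNorm_sub_le hp2
      (ε := ENNReal.ofReal (η / 2)) (by simpa using hη)
    obtain ⟨B, hB⟩ := hc.exists_bound_of_continuous hcont
    obtain ⟨S, hS⟩ := hc.isCompact.isBounded.subset_closedBall 0
    refine ⟨φ, B, S, hcont, hB, fun x hx => ?_, happ⟩
    by_contra hne
    have := hS (subset_tsupport _ (Function.mem_support.2 hne))
    rw [Real.closedBall_eq_Icc, zero_sub, zero_add] at this
    exact hx this
  choose φ B S hcont hB hS happ using happ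
  obtain ⟨t, -, htfin, ht⟩ := hK.finite_cover_balls (half_pos hη)
  obtain ⟨B', hB'⟩ := (htfin.image B).bddAbove
  obtain ⟨S', hS'⟩ := (htfin.image S).bddAbove
  refine ⟨max B' 1, max S' 1, by positivity, by positivity, fun h hh => ?_⟩
  obtain ⟨g, hgt, hg⟩ := mem_iUnion₂.1 (ht hh)
  refine ⟨φ g, (hcont g).aestronglyMeasurable, fun x => ?_, fun x hx => ?_, ?_⟩
  · exact (hB g x).trans ((hB' (mem_image_of_mem _ hgt)).trans (le_max_left _ _))
  · refine hS g x fun hx' => hx ?_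
    have := (hS' (mem_image_of_mem _ hgt)).trans (le_max_left S' 1)
    exact Icc_subset_Icc (neg_le_neg this) this hx'
  · have hsplit : ⇑h - φ g = (⇑h - ⇑g) + (⇑g - φ g) := by abel
    have hhg : eLpNorm (⇑h - ⇑g) p volume ≤ ENNReal.ofReal (η / 2) := by
      rw [← eLpNorm_congr_ae (Lp.coeFn_sub h g), ← Lp.enorm_def, ← ofReal_norm]
      refine ENNReal.ofReal_le_ofReal ?_
      rw [← dist_eq_norm]
      exact (Metric.mem_ball.1 hg).le
    rw [hsplit]
    calc _ ≤ eLpNorm (⇑h - ⇑g) p volume + eLpNorm (⇑g - φ g) p volume :=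
          eLpNorm_add_le ((Lp.aestronglyMeasurable h).sub (Lp.aestronglyMeasurable g))
            ((Lp.aestronglyMeasurable g).sub (hcont g).aestronglyMeasurable) Fact.out
      _ ≤ ENNReal.ofReal (η / 2) + ENNReal.ofReal (η / 2) := by gcongr; exact happ g
      _ = ENNReal.ofReal η := by
          rw [← ENNReal.ofReal_add (by positivity) (by positivity), add_halves]

/-- A function of size `a (2r)^{-1/p}` on a set of measure `r / 2` has `L^p` norm above `a / 8`. -/
theorem lt_eLpNorm_of_le_on {p : ℝ≥0∞} (hp1 : 1 ≤ p) (hp2 : p ≠ ⊤) {a r : ℝ} (ha : 0 < a)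
    (hr : 0 < r) {f : ℝ → ℂ} (hf : AEStronglyMeasurable f volume) {E : Set ℝ}
    (hE : ENNReal.ofReal (r / 2) ≤ volume E)
    (h : ∀ᵐ x : ℝ, x ∈ E → a * (2 * r) ^ (-(1 / p.toReal)) ≤ ‖f x‖) :
    ENNReal.ofReal (a / 8) < eLpNorm f p volume := by
  have hp0 : p ≠ 0 := (zero_lt_one.trans_le hp1).ne'
  have hp : 1 ≤ p.toReal := by
    simpa using ENNReal.toReal_mono hp2 hp1
  by_contra! hle
  have hcheb := mul_meas_ge_le_pow_eLpNorm' volume hp0 hp2 hf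
    (ENNReal.ofReal (a * (2 * r) ^ (-(1 / p.toReal))))
  have hEle : volume E ≤
      volume {x | ENNReal.ofReal (a * (2 * r) ^ (-(1 / p.toReal))) ≤ ‖f x‖ₑ} := by
    refine measure_mono_ae ?_
    filter_upwards [h] with x hx hxE
    change ENNReal.ofReal _ ≤ ‖f x‖ₑ
    rw [← ofReal_norm]
    exact ENNReal.ofReal_le_ofReal (hx hxE)
  have hmain : ENNReal.ofReal (a * (2 * r) ^ (-(1 / p.toReal))) ^ p.toReal *
      ENNReal.ofReal (r / 2) ≤ ENNReal.ofReal (a / 8) ^ p.toReal :=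
    (mul_le_mul_right (hE.trans hEle) _).trans (hcheb.trans (by gcongr))
  rw [ENNReal.ofReal_rpow_of_nonneg (by positivity) (by positivity),
    ENNReal.ofReal_rpow_of_nonneg (by positivity) (by positivity),
    ← ENNReal.ofReal_mul (by positivity), ENNReal.ofReal_le_ofReal_iff (by positivity),
    Real.mul_rpow ha.le (by positivity), ← Real.rpow_mul (by positivity),
    Real.div_rpow ha.le (by norm_num)] at hmain
  have hexp : -(1 / p.toReal) * p.toReal = -1 := by field_simp
  rw [hexp, Real.rpow_neg_one] at hmain
  have h8 : (8 : ℝ) ≤ 8 ^ p.toReal := Real.self_le_rpow_of_one_le (by norm_num) hp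
  have hapos : 0 < a ^ p.toReal := by positivity
  have h1 : a ^ p.toReal * (2 * r)⁻¹ * (r / 2) = a ^ p.toReal / 4 := by field_simp; ring
  have h2 : a ^ p.toReal / 8 ^ p.toReal ≤ a ^ p.toReal / 8 := by gcongr
  linarith

/-- Compactness of the commutator makes the mean oscillation small on intervals which are short,
long, or have a neighbour far from the origin. -/
theorem exists_meanOsc_lt {A : ℝ → ℝ} {L : ℝ} (hL : 0 < L)
    (hA : ∀ x₁ x₂ : ℝ, |A x₁ - A x₂| ≤ L * |x₁ - x₂|) (hAm : Measurable A)
    {p : ℝ≥0∞} [Fact (1 ≤ p)] (hp2 : p ≠ ⊤) {b : ℝ → ℝ} (hbm : Measurable b)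
    (hb : LocallyIntegrable b)
    (T : Lp ℂ p (volume : Measure ℝ) →L[ℂ] Lp ℂ p (volume : Measure ℝ))
    (hT : ∀ f : Lp ℂ p (volume : Measure ℝ), IsCommutatorFn A b ⇑f ⇑(T f))
    (hcpt : IsCompactOperator (⇑T)) {ε : ℝ} (hε : 0 < ε) :
    ∃ B S : ℝ, 0 < B ∧ 0 < S ∧ ∀ x₀ r : ℝ, 0 < r →
      (B ≤ (2 * r) ^ (-(1 / p.toReal)) ∨ 4 * S ≤ r ∨
        Disjoint (Ioo (x₀ + (2 * L + 3) * r) (x₀ + (2 * L + 5) * r)) (Icc (-S) S)) →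
      meanOsc b x₀ r < ε := by
  have hp1 : 1 ≤ p := Fact.out
  obtain ⟨K, hK, hTK⟩ := IsCompactOperator.image_closedBall_subset_compact
    (f := (T : Lp ℂ p (volume : Measure ℝ) →ₗ[ℂ] Lp ℂ p (volume : Measure ℝ))) hcpt 1
  set a : ℝ := (4 * (1 + L) * (2 * L + 5))⁻¹ * ε / 2 with ha
  have ha0 : 0 < a := by positivity
  obtain ⟨B, S, hB, hS, happ⟩ := exists_uniform_approx hp2 hK (by positivity : 0 < a / 8)
  refine ⟨B / a, S, by positivity, hS, fun x₀ r hr hcase => ?_⟩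
  by_contra! hosc
  obtain ⟨f, hf, E, hE, hEJ, hEvol, hlow⟩ :=
    exists_test_function hL hA hAm (zero_lt_one.trans_le hp1).ne' hp2 hbm hb hT x₀ hr
  obtain ⟨φ, hφm, hφB, hφS, hφ⟩ :=
    happ (T f) (hTK (mem_image_of_mem _ (mem_closedBall_zero_iff.2 hf)))
  set q : ℝ := (2 * r) ^ (-(1 / p.toReal)) with hq
  have hq0 : 0 < q := by positivity
  have hlow' : ∀ᵐ x : ℝ, x ∈ E → 2 * (a * q) ≤ ‖T f x‖ := by
    filter_upwards [hlow] with x hx hxE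
    refine le_trans ?_ (hx hxE)
    calc 2 * (a * q) = (4 * (1 + L) * (2 * L + 5))⁻¹ * ε * q := by rw [ha]; ring
      _ ≤ _ := by gcongr
  have hr2 : ENNReal.ofReal (r / 2) ≤ ENNReal.ofReal r := ENNReal.ofReal_le_ofReal (by linarith)
  have haq : a * q ≤ 2 * (a * q) := by nlinarith [mul_pos ha0 hq0]
  have hoff : ∀ᵐ x : ℝ, x ∈ E \ Icc (-S) S → a * q ≤ ‖(⇑(T f) - φ) x‖ := by
    filter_upwards [hlow'] with x hx hxE
    rw [Pi.sub_apply, hφS x hxE.2, sub_zero]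
    exact haq.trans (hx hxE.1)
  have hmeas := (Lp.aestronglyMeasurable (T f)).sub hφm
  refine absurd hφ (not_le.2 ?_)
  rcases hcase with hcase | hcase | hcase
  · refine lt_eLpNorm_of_le_on hp1 hp2 ha0 hr hmeas (hr2.trans hEvol) ?_
    filter_upwards [hlow'] with x hx hxE
    have h1 := norm_sub_norm_le (T f x) (φ x)
    have h2 := hφB x
    have h3 : B ≤ a * q := by
      rw [div_le_iff₀ ha0] at hcase
      linarith
    rw [Pi.sub_apply]
    linarith [hx hxE]
  · refine lt_eLpNorm_of_le_on hp1 hp2 ha0 hr hmeas ?_ hoff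
    calc ENNReal.ofReal (r / 2) ≤ ENNReal.ofReal (r - 2 * S) :=
          ENNReal.ofReal_le_ofReal (by linarith)
      _ = ENNReal.ofReal r - volume (Icc (-S) S) := by
          rw [Real.volume_Icc, ENNReal.ofReal_sub _ (by positivity)]
          congr 2
          ring
      _ ≤ volume E - volume (Icc (-S) S) := by gcongr
      _ ≤ volume (E \ Icc (-S) S) := le_measure_sdiff
  · refine lt_eLpNorm_of_le_on hp1 hp2 ha0 hr hmeas (hr2.trans hEvol) ?_
    rwa [(hcase.mono_left hEJ).sdiff_eq_left] at hoff

theorem meanOsc_congr_ae {b b' : ℝ → ℝ} (h : b =ᵐ[volume] b') : meanOsc b = meanOsc b' := by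
  funext x r
  have havg : intervalAvg b x r = intervalAvg b' x r := by
    rw [intervalAvg, intervalAvg, integral_congr_ae (ae_restrict_of_ae h)]
  rw [meanOsc, meanOsc, havg]
  congr 1
  refine integral_congr_ae (ae_restrict_of_ae ?_)
  filter_upwards [h] with y hy
  rw [hy]

theorem IsCommutatorFn.congr_ae {A b b' : ℝ → ℝ} {f g : ℝ → ℂ} (hc : IsCommutatorFn A b f g)
    (h : b =ᵐ[volume] b') : IsCommutatorFn A b' f g := by
  filter_upwards [hc, h] with x ⟨u, w, hu, hw, hg⟩ hx
  refine ⟨u, w, hu, hw.congr fun δ => integral_congr_ae (ae_restrict_of_ae ?_), hx ▸ hg⟩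
  filter_upwards [h] with y hy
  rw [hy]

/-- If `b ∈ BMO(ℝ)` and the commutator `[b, C_Γ]` is a compact operator on `L^p(ℝ)` for
some `1 < p < ∞`, then `b ∈ VMO(ℝ)`. -/
theorem commutator_compact_implies_vmo
    (A : ℝ → ℝ) (L : ℝ) (hL : 0 < L)
    (hA : ∀ x₁ x₂ : ℝ, |A x₁ - A x₂| ≤ L * |x₁ - x₂|)
    (p : ℝ≥0∞) (hp1 : 1 < p) (hp2 : p ≠ ⊤) [Fact (1 ≤ p)]
    (b : ℝ → ℝ) (hb : IsBMO b)
    (T : Lp ℂ p (volume : Measure ℝ) →L[ℂ] Lp ℂ p (volume : Measure ℝ))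
    (hT : ∀ f : Lp ℂ p (volume : Measure ℝ), IsCommutatorFn A b ⇑f ⇑(T f))
    (hcpt : IsCompactOperator (⇑T)) :
    IsVMO b := by
  have hAm : Measurable A :=
    (LipschitzWith.of_dist_le_mul (K := L.toNNReal) fun x y => by
      rw [Real.dist_eq, Real.dist_eq, Real.coe_toNNReal L hL.le]
      exact hA x y).continuous.measurable
  obtain ⟨-, hbloc, -⟩ := id hb
  have hbsm := hbloc.aestronglyMeasurable
  set b' := hbsm.mk b
  have hbb' : b =ᵐ[volume] b' := hbsm.ae_eq_mk
  have hb'm : Measurable b' := hbsm.stronglyMeasurable_mk.measurable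
  have hb'loc : LocallyIntegrable b' := hbloc.congr hbb'
  have hT' : ∀ f : Lp ℂ p (volume : Measure ℝ), IsCommutatorFn A b' ⇑f ⇑(T f) :=
    fun f => (hT f).congr_ae hbb'
  have key : ∀ ε : ℝ, 0 < ε → _ := fun ε hε =>
    exists_meanOsc_lt hL hA hAm hp2 hb'm hb'loc T hT' hcpt hε
  rw [← meanOsc_congr_ae hbb'] at key
  have hp : 0 < p.toReal := ENNReal.toReal_pos (zero_lt_one.trans hp1).ne' hp2
  refine ⟨hb, fun ε hε => ?_, fun ε hε => ?_, fun ε hε => ?_⟩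
  · obtain ⟨B, S, hB, hS, h⟩ := key ε hε
    refine ⟨B ^ (-p.toReal), by positivity, fun x r hr hrδ => h x r hr (Or.inl ?_)⟩
    calc B = (B ^ (-p.toReal)) ^ (-(1 / p.toReal)) := by
          rw [← Real.rpow_mul hB.le]
          have : -p.toReal * -(1 / p.toReal) = 1 := by field_simp
          rw [this, Real.rpow_one]
      _ ≤ (2 * r) ^ (-(1 / p.toReal)) :=
          Real.rpow_le_rpow_of_nonpos (by positivity) hrδ.le
            (neg_nonpos.2 (by positivity))
  · obtain ⟨B, S, hB, hS, h⟩ := key ε hε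
    exact ⟨8 * S, by positivity, fun x r hr hrR => h x r hr (Or.inr (Or.inl (by linarith)))⟩
  · obtain ⟨B, S, hB, hS, h⟩ := key ε hε
    refine ⟨S + (2 * L + 5) * (4 * S), by positivity, fun x r hr hdisj => ?_⟩
    rcases le_or_gt (4 * S) r with hrS | hrS
    · exact h x r hr (Or.inr (Or.inl hrS))
    refine h x r hr (Or.inr (Or.inr (Set.disjoint_left.2 fun y hy hyS => ?_)))
    have hx : x ∉ Ioo (-(S + (2 * L + 5) * (4 * S))) (S + (2 * L + 5) * (4 * S)) := fun hx =>
      (Set.eq_empty_iff_forall_notMem.1 hdisj x) ⟨⟨by linarith, by linarith⟩, hx⟩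
    have hJr : (2 * L + 5) * r < (2 * L + 5) * (4 * S) := by gcongr
    have hJ0 : 0 < (2 * L + 3) * r := by positivity
    have hS0 : 0 < (2 * L + 5) * (4 * S) := by positivity
    have h1 := hy.1
    have h2 := hy.2
    have h3 := hyS.1
    have h4 := hyS.2
    exact hx ⟨by linarith, by linarith⟩
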